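/- Let a, b be real numbers with a < 1, b < 1 and a + b = 1. Let Ξ₁, Ξ₂ : [0,1] → ℝ be smooth monotonically decreasing functions that are identically 1 on a neighborhood of 0 and identically 0 on an open neighborhood of the interval [1/2, 1], and let ε > 0 be such that Ξ₁(x)Ξ₂(x) = 1 for all x ∈ [0, ε]. Then, as t ↓ 0, β(t) = β₀ − (1/2) log t + O(t^{1/2} log(1/t)), where β₀ = (1/2) log(ε²) + (1/2)γ + log(2^{1/2} − 1) + 2 log 2 + ∫_{ε}^{1/2} Ξ₁(x)Ξ₂(x) x^{-1} dx + (1/2) ∫₀¹ q^{-1} ( (1+q)^{a-1}/(1-q)^{a} + (1-q)^{a-1}/(1+q)^{a} − 2/(1+q²)^{1/2} ) dq. -/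

import Mathlib

open MeasureTheory

/-- The heat content of `[0,1]` in `ℝ` with initial temperature `Ξ₁(x) x^{-a}` and
specific heat `Ξ₂(y) y^{-b}`. -/
noncomputable def heatContentCutoff (a b : ℝ) (Ξ₁ Ξ₂ : ℝ → ℝ) (t : ℝ) : ℝ :=
  (Real.sqrt (4 * Real.pi * t))⁻¹ *
    ∫ x in (0:ℝ)..1, ∫ y in (0:ℝ)..1,
      Real.exp (-(x - y) ^ 2 / (4 * t)) * Ξ₁ x * Ξ₂ y * x ^ (-a) * y ^ (-b)

open Set Filter Topology Real

theorem integrable_exp_neg_sq : Integrable (fun w : ℝ => Real.exp (-w ^ 2)) := by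
  simpa using integrable_exp_neg_mul_sq one_pos

theorem integral_Ioi_exp_neg_sq : ∫ w in Ioi (0:ℝ), Real.exp (-w ^ 2) = √Real.pi / 2 := by
  simpa using integral_gaussian_Ioi 1

theorem integrable_mul_exp_neg_sq : Integrable (fun w : ℝ => w * Real.exp (-w ^ 2)) := by
  simpa using integrable_mul_exp_neg_mul_sq one_pos

theorem integral_Ioi_mul_exp_neg_sq (V : ℝ) :
    ∫ w in Ioi V, w * Real.exp (-w ^ 2) = Real.exp (-V ^ 2) / 2 := by
  have hd : ∀ x ∈ Ioi V, HasDerivAt (fun w : ℝ => -(Real.exp (-w ^ 2) / 2))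
      (x * Real.exp (-x ^ 2)) x := by
    intro x _
    have := ((((hasDerivAt_id x).pow 2).neg.exp).div_const 2).neg
    convert! this using 1
    simp; ring
  have ht : Tendsto (fun w : ℝ => -(Real.exp (-w ^ 2) / 2)) atTop (𝓝 0) := by
    have h1 : Tendsto (fun w : ℝ => Real.exp (-w ^ 2)) atTop (𝓝 0) :=
      Real.tendsto_exp_neg_atTop_nhds_zero.comp (tendsto_pow_atTop two_ne_zero)
    simpa using (h1.div_const 2).neg
  rw [integral_Ioi_of_hasDerivAt_of_tendsto (by fun_prop) hd
    integrable_mul_exp_neg_sq.integrableOn ht]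
  ring

theorem integral_Ioi_log_mul_exp_neg_sq :
    ∫ v in Ioi (0:ℝ), Real.log v * Real.exp (-v ^ 2)
      = -(√Real.pi / 4) * (Real.eulerMascheroniConstant + 2 * Real.log 2) := by
  have hre : 0 < ((1 / 2 : ℝ) : ℂ).re := by norm_num
  have h1 := Complex.hasDerivAt_GammaIntegral hre
  have h2 : HasDerivAt Complex.Gamma
      (∫ t : ℝ in Ioi 0, (t : ℂ) ^ (((1 / 2 : ℝ) : ℂ) - 1) * (Real.log t * Real.exp (-t)))
      ((1 / 2 : ℝ) : ℂ) := by
    refine h1.congr_of_eventuallyEq ?_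
    have : {s : ℂ | 0 < s.re} ∈ 𝓝 ((1 / 2 : ℝ) : ℂ) :=
      (isOpen_lt continuous_const Complex.continuous_re).mem_nhds hre
    filter_upwards [this] with s hs using Complex.Gamma_eq_integral hs
  have h3 := h2.unique (by simpa using Complex.hasDerivAt_Gamma_one_half)
  have h4 : (∫ t : ℝ in Ioi 0, (t : ℂ) ^ (((1 / 2 : ℝ) : ℂ) - 1) * (Real.log t * Real.exp (-t)))
      = ((∫ t : ℝ in Ioi 0, t ^ ((1 / 2 : ℝ) - 1) * (Real.log t * Real.exp (-t)) : ℝ) : ℂ) := by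
    rw [← integral_complex_ofReal]
    refine setIntegral_congr_fun measurableSet_Ioi fun t ht => ?_
    have ht' : (0:ℝ) ≤ t := le_of_lt ht
    push_cast [Complex.ofReal_cpow ht']
    rfl
  rw [h4] at h3
  have h5 : (∫ t : ℝ in Ioi 0, t ^ ((1 / 2 : ℝ) - 1) * (Real.log t * Real.exp (-t)))
      = -√Real.pi * (Real.eulerMascheroniConstant + 2 * Real.log 2) := by
    apply Complex.ofReal_injective
    rw [h3, Complex.ofReal_mul, Complex.ofReal_add, Complex.ofReal_mul,
      Complex.ofReal_log zero_le_two]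
    push_cast
    ring
  rw [← integral_comp_rpow_Ioi_of_pos (p := 2) two_pos] at h5
  have h6 : ∀ x ∈ Ioi (0:ℝ), (2 * x ^ ((2:ℝ) - 1)) • ((x ^ (2:ℝ)) ^ ((1 / 2 : ℝ) - 1) *
      (Real.log (x ^ (2:ℝ)) * Real.exp (-x ^ (2:ℝ)))) = 4 * (Real.log x * Real.exp (-x ^ 2)) := by
    intro x hx
    have hx' : (0:ℝ) < x := hx
    rw [← Real.rpow_mul hx'.le, Real.log_rpow hx', Real.rpow_two, smul_eq_mul]
    have : x ^ ((2:ℝ) - 1) * x ^ ((2:ℝ) * (1 / 2 - 1)) = 1 := by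
      rw [← Real.rpow_add hx']; norm_num
    linear_combination (4 * Real.log x * Real.exp (-x ^ 2)) * this
  rw [setIntegral_congr_fun measurableSet_Ioi h6, integral_const_mul] at h5
  linarith

theorem integrableOn_log_mul_exp_neg_sq :
    IntegrableOn (fun v : ℝ => Real.log v * Real.exp (-v ^ 2)) (Ioi 0) := by
  by_contra h
  have h1 := integral_Ioi_log_mul_exp_neg_sq
  rw [integral_undef h] at h1
  have h2 : 0 < Real.eulerMascheroniConstant :=
    lt_trans (by norm_num) Real.one_half_lt_eulerMascheroniConstant
  have h3 : 0 < Real.log 2 := Real.log_pos one_lt_two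
  have h4 : 0 < √Real.pi := Real.sqrt_pos.2 Real.pi_pos
  have : 0 < (√Real.pi / 4) * (Real.eulerMascheroniConstant + 2 * Real.log 2) := by positivity
  linarith

/-- The average of `exp (-w ^ 2)` over `[0, c]`. -/
noncomputable def gaussMean (c : ℝ) : ℝ := ∫ s in (0:ℝ)..1, Real.exp (-(c * (1 - s)) ^ 2)

theorem mul_gaussMean (c : ℝ) : c * gaussMean c = ∫ w in (0:ℝ)..c, Real.exp (-w ^ 2) := by
  have := intervalIntegral.mul_integral_comp_sub_mul (a := 0) (b := 1)
    (f := fun w : ℝ => Real.exp (-w ^ 2)) c c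
  simp only [mul_one, mul_zero, sub_self, sub_zero] at this
  rw [← this, gaussMean]
  simp only [mul_sub, mul_one]

theorem continuous_gaussMean : Continuous gaussMean := by
  unfold gaussMean
  exact intervalIntegral.continuous_parametric_intervalIntegral_of_continuous' (by fun_prop) 0 1

theorem intervalIntegral_exp_neg_sq {c : ℝ} (hc : 0 ≤ c) :
    ∫ w in (0:ℝ)..c, Real.exp (-w ^ 2) = √Real.pi / 2 - ∫ w in Ioi c, Real.exp (-w ^ 2) := by
  rw [← integral_Ioi_exp_neg_sq, intervalIntegral.integral_Ioi_sub_Ioi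
    integrable_exp_neg_sq.integrableOn hc, intervalIntegral.integral_of_le hc]

theorem abs_gaussMean_sub_le {c : ℝ} (hc : 0 < c) :
    |gaussMean c - √Real.pi / (2 * c)| ≤ 1 / (2 * c ^ 2) := by
  have h1 := mul_gaussMean c
  rw [intervalIntegral_exp_neg_sq hc.le] at h1
  have h0 : 0 ≤ ∫ w in Ioi c, Real.exp (-w ^ 2) := by positivity
  have h2 : ∫ w in Ioi c, c * Real.exp (-w ^ 2) ≤ ∫ w in Ioi c, w * Real.exp (-w ^ 2) :=
    setIntegral_mono_on (integrable_exp_neg_sq.const_mul c).integrableOn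
      integrable_mul_exp_neg_sq.integrableOn measurableSet_Ioi fun w hw => by
        have : c < w := hw
        gcongr
  rw [integral_Ioi_mul_exp_neg_sq, integral_const_mul] at h2
  have h3 : Real.exp (-c ^ 2) ≤ 1 := Real.exp_le_one_iff.2 (by nlinarith [sq_nonneg c])
  have h4 : gaussMean c - √Real.pi / (2 * c) = -((∫ w in Ioi c, Real.exp (-w ^ 2)) / c) := by
    field_simp
    linarith
  rw [h4, abs_neg, abs_of_nonneg (by positivity), div_le_div_iff₀ hc (by positivity)]
  nlinarith

theorem abs_integral_gaussMean_sub_le {V : ℝ} (hV : 1 ≤ V) :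
    |2 / √Real.pi * (∫ v in (0:ℝ)..V, gaussMean v)
      - (Real.log V + Real.eulerMascheroniConstant / 2 + Real.log 2)| ≤ 1 / V := by
  have hV0 : 0 < V := by linarith
  have hpi : 0 < √Real.pi := Real.sqrt_pos.2 Real.pi_pos
  have hi1 : IntervalIntegrable gaussMean volume 0 V :=
    continuous_gaussMean.intervalIntegrable _ _
  have hi2 : IntervalIntegrable (fun v : ℝ => Real.log v * Real.exp (-v ^ 2)) volume 0 V :=
    intervalIntegral.intervalIntegrable_log'.mul_continuousOn (by fun_prop)
  have hd : ∀ v ∈ Ioo 0 V, HasDerivAt (fun v : ℝ => v * Real.log v * gaussMean v)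
      (gaussMean v + Real.log v * Real.exp (-v ^ 2)) v := by
    intro v hv
    have e1 : HasDerivAt (fun v : ℝ => ∫ w in (0:ℝ)..v, Real.exp (-w ^ 2))
        (Real.exp (-v ^ 2)) v :=
      intervalIntegral.integral_hasDerivAt_right (integrable_exp_neg_sq.intervalIntegrable)
        ((by fun_prop : Continuous fun w : ℝ => Real.exp (-w ^ 2)).stronglyMeasurableAtFilter _ _)
        (by fun_prop)
    have e2 := (Real.hasDerivAt_log hv.1.ne').mul e1
    convert! e2 using 1
    · ext x
      simp only [Pi.mul_apply, ← mul_gaussMean]; ring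
    · rw [← mul_gaussMean]; field_simp [hv.1.ne']
  have hF := intervalIntegral.integral_eq_sub_of_hasDerivAt_of_le hV0.le
    (Continuous.continuousOn (Real.continuous_mul_log.mul continuous_gaussMean)) hd (hi1.add hi2)
  rw [intervalIntegral.integral_add hi1 hi2] at hF
  have hm := mul_gaussMean V
  rw [intervalIntegral_exp_neg_sq hV0.le] at hm
  have hL : ∫ v in (0:ℝ)..V, Real.log v * Real.exp (-v ^ 2) =
      -(√Real.pi / 4) * (Real.eulerMascheroniConstant + 2 * Real.log 2)
        - ∫ v in Ioi V, Real.log v * Real.exp (-v ^ 2) := by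
    rw [← integral_Ioi_log_mul_exp_neg_sq, intervalIntegral.integral_Ioi_sub_Ioi
      integrableOn_log_mul_exp_neg_sq hV0.le, intervalIntegral.integral_of_le hV0.le]
  have hiL : IntegrableOn (fun v : ℝ => Real.log v * Real.exp (-v ^ 2)) (Ioi V) :=
    integrableOn_log_mul_exp_neg_sq.mono_set (Ioi_subset_Ioi hV0.le)
  have hiV : IntegrableOn (fun v : ℝ => Real.log V * Real.exp (-v ^ 2)) (Ioi V) :=
    (integrable_exp_neg_sq.const_mul _).integrableOn
  have hlow : ∫ v in Ioi V, Real.log V * Real.exp (-v ^ 2)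
      ≤ ∫ v in Ioi V, Real.log v * Real.exp (-v ^ 2) :=
    setIntegral_mono_on hiV hiL measurableSet_Ioi fun v hv => by
      have := Real.log_le_log hV0 (le_of_lt hv)
      gcongr
  have hup : ∫ v in Ioi V, Real.log v * Real.exp (-v ^ 2)
      ≤ ∫ v in Ioi V, v * Real.exp (-v ^ 2) :=
    setIntegral_mono_on hiL integrable_mul_exp_neg_sq.integrableOn measurableSet_Ioi
      fun v hv => by
        have := Real.log_le_self (hV0.le.trans (le_of_lt hv))
        gcongr
  have hnn : 0 ≤ ∫ v in Ioi V, Real.log V * Real.exp (-v ^ 2) := by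
    have := Real.log_nonneg hV
    positivity
  rw [integral_Ioi_mul_exp_neg_sq] at hup
  rw [integral_const_mul] at hlow hnn
  set T := ∫ w in Ioi V, Real.exp (-w ^ 2)
  set S := ∫ v in Ioi V, Real.log v * Real.exp (-v ^ 2)
  have key : 2 / √Real.pi * (∫ v in (0:ℝ)..V, gaussMean v)
      - (Real.log V + Real.eulerMascheroniConstant / 2 + Real.log 2)
      = 2 / √Real.pi * (S - Real.log V * T) := by
    have : (∫ v in (0:ℝ)..V, gaussMean v) = Real.log V * (√Real.pi / 2 - T)
        - (-(√Real.pi / 4) * (Real.eulerMascheroniConstant + 2 * Real.log 2) - S) := by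
      simp only [Pi.mul_apply] at hF
      rw [hL] at hF
      rw [← hm]
      simp only [zero_mul, sub_zero] at hF
      linear_combination hF
    rw [this]
    field_simp
    ring
  have hsp : 1 ≤ √Real.pi := Real.one_le_sqrt.2 (by linarith [Real.pi_gt_three])
  have hexp : Real.exp (-V ^ 2) ≤ 1 / V := by
    rw [Real.exp_neg, one_div]
    gcongr
    nlinarith [Real.add_one_le_exp (V ^ 2)]
  rw [key, abs_of_nonneg (mul_nonneg (by positivity) (by linarith))]
  calc 2 / √Real.pi * (S - Real.log V * T) ≤ 2 / 1 * (Real.exp (-V ^ 2) / 2) := by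
        gcongr
        linarith
    _ ≤ 1 / V := by linarith

theorem intervalIntegrable_rpow_neg {b : ℝ} (hb : b < 1) :
    IntervalIntegrable (fun s : ℝ => s ^ (-b)) volume 0 1 :=
  intervalIntegral.intervalIntegrable_rpow' (by linarith)

theorem integral_rpow_neg {b : ℝ} (hb : b < 1) :
    ∫ s in (0:ℝ)..1, s ^ (-b) = 1 / (1 - b) := by
  rw [integral_rpow (Or.inl (by linarith)), Real.one_rpow, Real.zero_rpow (by linarith)]
  ring

theorem one_le_rpow_neg {b s : ℝ} (hb0 : 0 < b) (hs : s ∈ Ioc (0:ℝ) 1) : 1 ≤ s ^ (-b) :=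
  Real.one_le_rpow_of_pos_of_le_one_of_nonpos hs.1 hs.2 (by linarith)

theorem rpow_neg_sub_one_le {b s : ℝ} (hb : b < 1) (hs : s ∈ Ioc (0:ℝ) 1) :
    s ^ (-b) - 1 ≤ s ^ (-b) * (1 - s) := by
  have h1 : s ^ (-b) * s ≤ 1 := by
    rw [← Real.rpow_add_one hs.1.ne']
    exact Real.rpow_le_one hs.1.le hs.2 (by linarith)
  linarith

theorem sq_mul_exp_neg_sq_le_one (y : ℝ) : y ^ 2 * Real.exp (-y ^ 2) ≤ 1 := by
  rw [Real.exp_neg, ← div_eq_mul_inv, div_le_one (Real.exp_pos _)]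
  linarith [Real.add_one_le_exp (y ^ 2)]

theorem integral_one_sub_mul_exp_le {c : ℝ} (hc : 0 < c) :
    ∫ s in (0:ℝ)..1, (1 - s) * Real.exp (-(c * (1 - s)) ^ 2) ≤ 1 / (2 * c ^ 2) := by
  have hd : ∀ s ∈ uIcc (0:ℝ) 1,
      HasDerivAt (fun s : ℝ => Real.exp (-(c * (1 - s)) ^ 2) / (2 * c ^ 2))
        ((1 - s) * Real.exp (-(c * (1 - s)) ^ 2)) s := by
    intro s _
    have := (((((hasDerivAt_id s).const_sub 1).const_mul c).pow 2).neg.exp).div_const (2 * c ^ 2)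
    convert! this using 1
    simp
    field_simp
  rw [intervalIntegral.integral_eq_sub_of_hasDerivAt hd
    (Continuous.intervalIntegrable (by fun_prop) _ _)]
  have : 0 ≤ Real.exp (-(c * (1 - 0)) ^ 2) / (2 * c ^ 2) := by positivity
  simp only [sub_self, mul_zero, ne_eq, OfNat.ofNat_ne_zero, not_false_eq_true, zero_pow, neg_zero,
    Real.exp_zero]
  linarith

/-- The constant in `integral_rpow_neg_mul_exp_le`. -/
noncomputable def gaussConst (b : ℝ) : ℝ := 1 / 2 + 1 / (1 - b)

theorem gaussConst_pos {b : ℝ} (hb : b < 1) : 0 < gaussConst b := by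
  have : 0 < 1 - b := by linarith
  unfold gaussConst
  positivity

theorem integral_rpow_neg_mul_exp_le {b c : ℝ} (hb : b < 1) (hc : 0 < c) :
    ∫ s in (0:ℝ)..1, s ^ (-b) * ((1 - s) * Real.exp (-(c * (1 - s)) ^ 2))
      ≤ gaussConst b / c ^ 2 := by
  have hi := intervalIntegrable_rpow_neg hb
  have hi1 : IntervalIntegrable (fun s : ℝ => (1 - s) * Real.exp (-(c * (1 - s)) ^ 2))
    volume 0 1 := Continuous.intervalIntegrable (by fun_prop) _ _
  have hi2 : IntervalIntegrable (fun s : ℝ => s ^ (-b) * (c ^ 2)⁻¹) volume 0 1 :=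
    hi.mul_const _
  have h1 : ∫ s in (0:ℝ)..1, s ^ (-b) * ((1 - s) * Real.exp (-(c * (1 - s)) ^ 2)) ≤
      ∫ s in (0:ℝ)..1, ((1 - s) * Real.exp (-(c * (1 - s)) ^ 2) + s ^ (-b) * (c ^ 2)⁻¹) := by
    refine intervalIntegral.integral_mono_on_of_le_Ioo zero_le_one
      (hi.mul_continuousOn (by fun_prop)) (hi1.add hi2) fun s hs => ?_
    have h2 := rpow_neg_sub_one_le hb ⟨hs.1, hs.2.le⟩
    have h3 : 0 ≤ (1 - s) * Real.exp (-(c * (1 - s)) ^ 2) :=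
      mul_nonneg (by linarith [hs.2]) (Real.exp_pos _).le
    have h4 := sq_mul_exp_neg_sq_le_one (c * (1 - s))
    have h5 : (1 - s) ^ 2 * Real.exp (-(c * (1 - s)) ^ 2) ≤ (c ^ 2)⁻¹ := by
      rw [← one_div, le_div_iff₀ (by positivity)]
      linarith
    have h6 : 0 ≤ s ^ (-b) := Real.rpow_nonneg hs.1.le _
    have h7 := mul_le_mul_of_nonneg_left h5 h6
    have h8 := mul_le_mul_of_nonneg_right h2 h3
    nlinarith
  rw [intervalIntegral.integral_add hi1 hi2, intervalIntegral.integral_mul_const,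
    integral_rpow_neg hb] at h1
  have h2 := integral_one_sub_mul_exp_le hc
  calc _ ≤ _ := h1
    _ ≤ 1 / (2 * c ^ 2) + 1 / (1 - b) * (c ^ 2)⁻¹ := by gcongr
    _ = gaussConst b / c ^ 2 := by
      have : 1 - b ≠ 0 := by linarith
      unfold gaussConst
      field_simp

theorem continuous_integral_mul {w : ℝ → ℝ} {k : ℝ → ℝ → ℝ}
    (hw : IntervalIntegrable w volume 0 1) (hk : Continuous (Function.uncurry k))
    (hb : ∀ x s, |k x s| ≤ 1) : Continuous fun x => ∫ s in (0:ℝ)..1, w s * k x s := by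
  refine intervalIntegral.continuous_of_dominated_interval (bound := fun s => |w s|) ?_ ?_
    hw.abs ?_
  · intro x
    have hx : Continuous (k x) := hk.comp (Continuous.prodMk_right x)
    exact (hw.mul_continuousOn hx.continuousOn).def'.aestronglyMeasurable
  · intro x
    refine Filter.Eventually.of_forall fun s _ => ?_
    rw [Real.norm_eq_abs, abs_mul]
    exact mul_le_of_le_one_right (abs_nonneg _) (hb x s)
  · refine Filter.Eventually.of_forall fun s _ => ?_
    exact continuous_const.mul (hk.comp (Continuous.prodMk_left s))

/-- The Gaussian integral with weight `s ^ (-b) - 1`. -/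
noncomputable def gaussExcess (b c : ℝ) : ℝ :=
  ∫ s in (0:ℝ)..1, (s ^ (-b) - 1) * Real.exp (-(c * (1 - s)) ^ 2)

theorem intervalIntegrable_rpow_neg_sub_one {b : ℝ} (hb : b < 1) :
    IntervalIntegrable (fun s : ℝ => s ^ (-b) - 1) volume 0 1 :=
  (intervalIntegrable_rpow_neg hb).sub (by simp)

theorem exp_neg_sq_le_one (y : ℝ) : Real.exp (-y ^ 2) ≤ 1 :=
  Real.exp_le_one_iff.2 (by nlinarith [sq_nonneg y])

theorem continuous_gaussExcess {b : ℝ} (hb : b < 1) : Continuous (gaussExcess b) := by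
  refine continuous_integral_mul (k := fun c s => Real.exp (-(c * (1 - s)) ^ 2))
    (intervalIntegrable_rpow_neg_sub_one hb) (by fun_prop) fun x s => ?_
  rw [abs_of_pos (Real.exp_pos _)]
  exact exp_neg_sq_le_one _

theorem gaussExcess_nonneg {b : ℝ} (hb0 : 0 < b) (c : ℝ) : 0 ≤ gaussExcess b c := by
  refine intervalIntegral.integral_nonneg_of_ae_restrict zero_le_one ?_
  have : ∀ᵐ s : ℝ ∂volume, s ≠ 0 := by simp [ae_iff]
  filter_upwards [ae_restrict_mem measurableSet_Icc, ae_restrict_of_ae this] with s hs hs0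
  have := one_le_rpow_neg hb0 ⟨lt_of_le_of_ne hs.1 (Ne.symm hs0), hs.2⟩
  exact mul_nonneg (by linarith) (Real.exp_pos _).le

theorem gaussExcess_le {b c : ℝ} (hb : b < 1) (hc : 0 < c) :
    gaussExcess b c ≤ gaussConst b / c ^ 2 := by
  refine le_trans ?_ (integral_rpow_neg_mul_exp_le hb hc)
  refine intervalIntegral.integral_mono_on_of_le_Ioo zero_le_one
    ((intervalIntegrable_rpow_neg_sub_one hb).mul_continuousOn (by fun_prop))
    ((intervalIntegrable_rpow_neg hb).mul_continuousOn (by fun_prop)) fun s hs => ?_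
  have := rpow_neg_sub_one_le hb ⟨hs.1, hs.2.le⟩
  rw [← mul_assoc]
  gcongr

/-- The total excess `∫₀¹ (s ^ (-b) - 1) / (1 - s) ds`. -/
noncomputable def excessIntegral (b : ℝ) : ℝ := ∫ s in (0:ℝ)..1, (s ^ (-b) - 1) / (1 - s)

theorem intervalIntegrable_excess {b : ℝ} (hb0 : 0 < b) (hb : b < 1) :
    IntervalIntegrable (fun s : ℝ => (s ^ (-b) - 1) / (1 - s)) volume 0 1 := by
  refine (intervalIntegrable_rpow_neg hb).mono_fun
    (Measurable.aestronglyMeasurable (by fun_prop)) ?_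
  rw [uIoc_of_le zero_le_one]
  filter_upwards [ae_restrict_mem measurableSet_Ioc] with s hs
  have h1 := one_le_rpow_neg hb0 hs
  have h2 := rpow_neg_sub_one_le hb hs
  have h3 : 0 ≤ 1 - s := by linarith [hs.2]
  rw [Real.norm_of_nonneg (div_nonneg (by linarith) h3), Real.norm_of_nonneg (by linarith)]
  exact div_le_of_le_mul₀ h3 (by linarith) h2

theorem integral_Ioi_exp_neg_mul_sq (p : ℝ) (hp : 0 ≤ p) :
    ∫ v in Ioi (0:ℝ), Real.exp (-(v * p) ^ 2) = √Real.pi / 2 / p := by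
  have := integral_gaussian_Ioi (p ^ 2)
  rw [Real.sqrt_div Real.pi_pos.le, Real.sqrt_sq hp] at this
  rw [div_right_comm, ← this]
  congr with v
  ring_nf

theorem integrable_gaussExcess_kernel {b : ℝ} (hb0 : 0 < b) (hb : b < 1) :
    Integrable (fun z : ℝ × ℝ => (z.1 ^ (-b) - 1) * Real.exp (-(z.2 * (1 - z.1)) ^ 2))
      ((volume.restrict (Ioc (0:ℝ) 1)).prod (volume.restrict (Ioi (0:ℝ)))) := by
  rw [integrable_prod_iff (by
    apply Measurable.aestronglyMeasurable
    measurability)]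
  constructor
  · filter_upwards [ae_restrict_mem measurableSet_Ioc] with s hs
    rcases eq_or_lt_of_le hs.2 with rfl | h1
    · simp
    · refine Integrable.const_mul ?_ _
      have h2 : 0 < (1 - s) ^ 2 := by nlinarith
      have := (integrable_exp_neg_mul_sq h2).integrableOn (s := Ioi 0)
      refine this.congr (Filter.Eventually.of_forall fun v => ?_)
      ring_nf
  · have h := ((intervalIntegrable_excess hb0 hb).const_mul (√Real.pi / 2)).1
    refine h.congr ?_
    filter_upwards [ae_restrict_mem measurableSet_Ioc] with s hs
    have h1 := one_le_rpow_neg hb0 hs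
    have h2 : ∀ v : ℝ, ‖(s ^ (-b) - 1) * Real.exp (-(v * (1 - s)) ^ 2)‖
        = (s ^ (-b) - 1) * Real.exp (-(v * (1 - s)) ^ 2) := fun v =>
      Real.norm_of_nonneg (mul_nonneg (by linarith) (Real.exp_pos _).le)
    simp only [h2]
    rw [integral_const_mul, integral_Ioi_exp_neg_mul_sq _ (by linarith [hs.2])]
    ring

theorem integrableOn_gaussExcess {b : ℝ} (hb0 : 0 < b) (hb : b < 1) :
    IntegrableOn (gaussExcess b) (Ioi 0) := by
  have := (integrable_gaussExcess_kernel hb0 hb).integral_prod_right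
  unfold gaussExcess
  simp only [intervalIntegral.integral_of_le zero_le_one]
  exact this

theorem integral_Ioi_gaussExcess {b : ℝ} (hb0 : 0 < b) (hb : b < 1) :
    ∫ v in Ioi (0:ℝ), gaussExcess b v = √Real.pi / 2 * excessIntegral b := by
  have h := integral_integral_swap
    (f := fun s v => (s ^ (-b) - 1) * Real.exp (-(v * (1 - s)) ^ 2))
    (integrable_gaussExcess_kernel hb0 hb)
  simp only [gaussExcess, excessIntegral, intervalIntegral.integral_of_le zero_le_one]
  rw [← h, ← integral_const_mul]
  refine setIntegral_congr_fun measurableSet_Ioc fun s hs => ?_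
  rw [integral_const_mul, integral_Ioi_exp_neg_mul_sq _ (by linarith [hs.2])]
  ring

theorem abs_integral_mul_gaussExcess_sub_le {b δ h : ℝ} {φ : ℝ → ℝ} (hb0 : 0 < b) (hb : b < 1)
    (hδ : 0 < δ) (hh : 0 < h) (hφc : Continuous φ) (hφ0 : ∀ x, 0 ≤ φ x) (hφ1 : ∀ x, φ x ≤ 1)
    (hone : ∀ x ≤ δ, φ x = 1) (hzero : ∀ x, 1 / 2 ≤ x → φ x = 0) :
    |(∫ x in (0:ℝ)..1, φ x * gaussExcess b (h⁻¹ * x)) - h * (√Real.pi / 2 * excessIntegral b)|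
      ≤ gaussConst b * h ^ 2 / δ := by
  have hh' : 0 < h⁻¹ := inv_pos.2 hh
  have hK := gaussConst_pos hb
  have hi : IntegrableOn (fun x => gaussExcess b (h⁻¹ * x)) (Ioi 0) := by
    rw [integrableOn_Ioi_comp_mul_left_iff _ _ hh', mul_zero]
    exact integrableOn_gaussExcess hb0 hb
  have hint : ∫ x in Ioi (0:ℝ), gaussExcess b (h⁻¹ * x)
      = h * (√Real.pi / 2 * excessIntegral b) := by
    rw [integral_comp_mul_left_Ioi _ _ hh', mul_zero, inv_inv, smul_eq_mul,
      integral_Ioi_gaussExcess hb0 hb]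
  have h1 : ∫ x in (0:ℝ)..1, φ x * gaussExcess b (h⁻¹ * x)
      = ∫ x in Ioi (0:ℝ), φ x * gaussExcess b (h⁻¹ * x) := by
    rw [intervalIntegral.integral_of_le zero_le_one]
    refine (setIntegral_eq_of_subset_of_forall_sdiff_eq_zero measurableSet_Ioi
      Ioc_subset_Ioi_self fun x hx => ?_).symm
    have : 1 < x := by
      by_contra hcon
      exact hx.2 ⟨hx.1, not_lt.1 hcon⟩
    rw [hzero x (by linarith), zero_mul]
  have hi2 : IntegrableOn (fun x => φ x * gaussExcess b (h⁻¹ * x)) (Ioi 0) :=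
    Integrable.bdd_mul (c := 1) hi hφc.aestronglyMeasurable (Filter.Eventually.of_forall fun x => by
      rw [Real.norm_of_nonneg (hφ0 x)]; exact hφ1 x)
  rw [h1, ← hint, ← integral_sub hi2 hi, ← Real.norm_eq_abs]
  have hg : IntegrableOn (fun x : ℝ => gaussConst b * h ^ 2 * x ^ (-2 : ℝ)) (Ioi δ) :=
    (integrableOn_Ioi_rpow_of_lt (by norm_num) hδ).const_mul _
  have hgi : ∫ x in Ioi (0:ℝ), (Ioi δ).indicator
      (fun x : ℝ => gaussConst b * h ^ 2 * x ^ (-2 : ℝ)) x = gaussConst b * h ^ 2 / δ := by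
    rw [setIntegral_indicator measurableSet_Ioi, Ioi_inter_Ioi, sup_eq_right.2 hδ.le,
      integral_const_mul, integral_Ioi_rpow_of_lt (by norm_num) hδ]
    norm_num
    rw [Real.rpow_neg_one]
    rfl
  rw [← hgi]
  refine norm_integral_le_of_norm_le
    ((integrable_indicator_iff measurableSet_Ioi).2 hg).integrableOn ?_
  filter_upwards [ae_restrict_mem measurableSet_Ioi] with x hx
  by_cases hxδ : x ≤ δ
  · rw [hone x hxδ]
    simp [hxδ]
  · have hxδ' : x ∈ Ioi δ := not_le.1 hxδ
    have hx0 : (0:ℝ) < x := hx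
    rw [indicator_of_mem hxδ', Real.norm_eq_abs, abs_sub_comm, abs_of_nonneg]
    · have h2 := gaussExcess_le (c := h⁻¹ * x) hb (by positivity)
      have h3 := gaussExcess_nonneg hb0 (h⁻¹ * x)
      have h4 : gaussConst b / (h⁻¹ * x) ^ 2 = gaussConst b * h ^ 2 * x ^ (-2 : ℝ) := by
        rw [Real.rpow_neg hx0.le, Real.rpow_two]
        field_simp
      rw [← h4]
      nlinarith [mul_nonneg (hφ0 x) h3]
    · have h3 := gaussExcess_nonneg hb0 (h⁻¹ * x)
      nlinarith [hφ1 x]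

theorem image_one_sub_div_one_add_Ioo :
    (fun q : ℝ => (1 - q) / (1 + q)) '' Ioo 0 1 = Ioo 0 1 := by
  have hmap : ∀ q ∈ Ioo (0:ℝ) 1, (1 - q) / (1 + q) ∈ Ioo (0:ℝ) 1 := fun q hq =>
    ⟨div_pos (by linarith [hq.2]) (by linarith [hq.1]),
      (div_lt_one (by linarith [hq.1])).2 (by linarith [hq.1])⟩
  refine Subset.antisymm (image_subset_iff.2 hmap) fun s hs => ⟨_, hmap s hs, ?_⟩
  have : 1 + s ≠ 0 := by linarith [hs.1]
  field_simp
  ring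

theorem injOn_one_sub_div_one_add :
    InjOn (fun q : ℝ => (1 - q) / (1 + q)) (Ioo 0 1) := by
  intro x hx y hy hxy
  have h1 : 1 + x ≠ 0 := by linarith [hx.1]
  have h2 : 1 + y ≠ 0 := by linarith [hy.1]
  simp only [div_eq_div_iff h1 h2] at hxy
  linarith

theorem hasDerivAt_one_sub_div_one_add {q : ℝ} (hq : 1 + q ≠ 0) :
    HasDerivAt (fun q : ℝ => (1 - q) / (1 + q)) (-2 / (1 + q) ^ 2) q := by
  convert! ((hasDerivAt_id q).const_sub 1).div ((hasDerivAt_id q).const_add 1) hq using 1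
  simp
  ring

theorem excess_comp_one_sub_div_one_add {c q : ℝ} (hq : q ∈ Ioo (0:ℝ) 1) :
    |-2 / (1 + q) ^ 2| • ((((1 - q) / (1 + q)) ^ (-c) - 1) / (1 - (1 - q) / (1 + q)))
      = q⁻¹ * ((1 + q) ^ (c - 1) / (1 - q) ^ c - (1 + q)⁻¹) := by
  have h1 : 0 < 1 + q := by linarith [hq.1]
  have h2 : 0 < 1 - q := by linarith [hq.2]
  have h3 := hq.1
  have h4 : |-2 / (1 + q) ^ 2| = 2 / (1 + q) ^ 2 := by
    rw [abs_div, abs_neg, abs_two, abs_of_pos (by positivity)]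
  rw [h4, Real.rpow_neg (by positivity), Real.div_rpow h2.le h1.le, Real.rpow_sub_one h1.ne',
    smul_eq_mul]
  have h5 : 1 - (1 - q) / (1 + q) = 2 * q / (1 + q) := by field_simp; ring
  rw [h5]
  have h6 : 0 < (1 + q) ^ c := by positivity
  have h7 : 0 < (1 - q) ^ c := by positivity
  field_simp

theorem excessIntegral_eq {c : ℝ} (hc0 : 0 < c) (hc : c < 1) :
    IntervalIntegrable (fun q : ℝ => q⁻¹ * ((1 + q) ^ (c - 1) / (1 - q) ^ c - (1 + q)⁻¹))
        volume 0 1 ∧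
      excessIntegral c
        = ∫ q in (0:ℝ)..1, q⁻¹ * ((1 + q) ^ (c - 1) / (1 - q) ^ c - (1 + q)⁻¹) := by
  have hd : ∀ q ∈ Ioo (0:ℝ) 1, HasDerivWithinAt (fun q : ℝ => (1 - q) / (1 + q))
      (-2 / (1 + q) ^ 2) (Ioo 0 1) q := fun q hq =>
    (hasDerivAt_one_sub_div_one_add (by linarith [hq.1])).hasDerivWithinAt
  have h1 := integrableOn_image_iff_integrableOn_abs_deriv_smul measurableSet_Ioo hd
    injOn_one_sub_div_one_add (fun s : ℝ => (s ^ (-c) - 1) / (1 - s))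
  have h2 := integral_image_eq_integral_abs_deriv_smul measurableSet_Ioo hd
    injOn_one_sub_div_one_add (fun s : ℝ => (s ^ (-c) - 1) / (1 - s))
  have hcongr : EqOn (fun q : ℝ => |-2 / (1 + q) ^ 2| •
      ((((1 - q) / (1 + q)) ^ (-c) - 1) / (1 - (1 - q) / (1 + q))))
      (fun q : ℝ => q⁻¹ * ((1 + q) ^ (c - 1) / (1 - q) ^ c - (1 + q)⁻¹)) (Ioo 0 1) :=
    fun q hq => excess_comp_one_sub_div_one_add hq
  rw [image_one_sub_div_one_add_Ioo] at h1 h2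
  rw [setIntegral_congr_fun measurableSet_Ioo hcongr] at h2
  rw [integrableOn_congr_fun hcongr measurableSet_Ioo] at h1
  constructor
  · rw [intervalIntegrable_iff_integrableOn_Ioo_of_le zero_le_one]
    exact h1.1 ((intervalIntegrable_iff_integrableOn_Ioo_of_le zero_le_one).1
      (intervalIntegrable_excess hc0 hc))
  · rw [excessIntegral, intervalIntegral.integral_of_le zero_le_one,
      intervalIntegral.integral_of_le zero_le_one, integral_Ioc_eq_integral_Ioo,
      integral_Ioc_eq_integral_Ioo, h2]

theorem integral_inv_mul_two_div_sqrt_sub :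
    IntervalIntegrable (fun q : ℝ => q⁻¹ * (2 / √(1 + q ^ 2) - 2 / (1 + q))) volume 0 1 ∧
      ∫ q in (0:ℝ)..1, q⁻¹ * (2 / √(1 + q ^ 2) - 2 / (1 + q))
        = 2 * (2 * Real.log 2 + Real.log (√2 - 1)) := by
  have hsq : ∀ q : ℝ, 0 < √(1 + q ^ 2) := fun q => Real.sqrt_pos.2 (by positivity)
  have hcont : ContinuousOn (fun q : ℝ => 2 * (1 / (1 + q)
      - q / √(1 + q ^ 2) / (1 + √(1 + q ^ 2)))) (uIcc 0 1) := by
    rw [uIcc_of_le zero_le_one]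
    refine continuousOn_const.mul (ContinuousOn.sub ?_ ?_)
    · exact continuousOn_const.div (by fun_prop) fun q hq => by linarith [hq.1]
    · refine ContinuousOn.div (ContinuousOn.div (by fun_prop) (by fun_prop)
        fun q _ => (hsq q).ne') (by fun_prop) fun q _ => ?_
      have := hsq q
      positivity
  have hcongr : EqOn (fun q : ℝ => 2 * (1 / (1 + q) - q / √(1 + q ^ 2) / (1 + √(1 + q ^ 2))))
      (fun q : ℝ => q⁻¹ * (2 / √(1 + q ^ 2) - 2 / (1 + q))) (uIoc 0 1) := by
    intro q hq
    rw [uIoc_of_le zero_le_one] at hq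
    have h1 := hq.1
    have h2 := hsq q
    have h3 : √(1 + q ^ 2) ^ 2 = 1 + q ^ 2 := Real.sq_sqrt (by positivity)
    simp only []
    field_simp
    linear_combination (1 + q) * h3
  have hi := hcont.intervalIntegrable (μ := volume)
  refine ⟨hi.congr hcongr, ?_⟩
  rw [← intervalIntegral.integral_congr_ae (Filter.Eventually.of_forall fun q hq => hcongr hq)]
  have hd : ∀ q ∈ uIcc (0:ℝ) 1, HasDerivAt
      (fun q : ℝ => 2 * (Real.log (1 + q) - Real.log (1 + √(1 + q ^ 2))))
      (2 * (1 / (1 + q) - q / √(1 + q ^ 2) / (1 + √(1 + q ^ 2)))) q := by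
    intro q hq
    rw [uIcc_of_le zero_le_one] at hq
    have h1 : 1 + q ≠ 0 := by linarith [hq.1]
    have h2 := hsq q
    have e1 := ((hasDerivAt_id q).const_add 1).log h1
    have e2 := (((((hasDerivAt_id q).pow 2).const_add 1).sqrt
      (by simp; positivity)).const_add 1).log (by simp; positivity)
    convert! (e1.sub e2).const_mul 2 using 1
    simp
    field_simp
  rw [intervalIntegral.integral_eq_sub_of_hasDerivAt hd hi]
  have hs2 : 1 < √2 := by
    rw [Real.lt_sqrt] <;> norm_num
  have h4 : Real.log (√2 - 1) = -Real.log (1 + √2) := by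
    rw [← Real.log_inv]
    congr 1
    apply eq_inv_of_mul_eq_one_left
    have : √2 ^ 2 = 2 := Real.sq_sqrt (by norm_num)
    linear_combination this
  rw [h4]
  norm_num
  ring

theorem excessIntegral_add {a b : ℝ} (ha0 : 0 < a) (ha : a < 1) (hab : a + b = 1) :
    excessIntegral a + excessIntegral b
      = (∫ q in (0:ℝ)..1, q⁻¹ * ((1 + q) ^ (a - 1) / (1 - q) ^ a
          + (1 - q) ^ (a - 1) / (1 + q) ^ a - 2 / √(1 + q ^ 2)))
        + 2 * (2 * Real.log 2 + Real.log (√2 - 1)) := by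
  obtain ⟨hia, hea⟩ := excessIntegral_eq ha0 ha
  obtain ⟨hib, heb⟩ := excessIntegral_eq (c := b) (by linarith) (by linarith)
  obtain ⟨hig, heg⟩ := integral_inv_mul_two_div_sqrt_sub
  rw [hea, heb, ← heg, ← sub_eq_iff_eq_add, ← intervalIntegral.integral_add hia hib,
    ← intervalIntegral.integral_sub (hia.add hib) hig]
  simp only [intervalIntegral.integral_of_le zero_le_one, integral_Ioc_eq_integral_Ioo]
  refine setIntegral_congr_fun measurableSet_Ioo fun q hq => ?_
  have h1 : 0 < 1 + q := by linarith [hq.1]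
  have h2 : 0 < 1 - q := by linarith [hq.2]
  have h3 : (1 + q) ^ (b - 1) / (1 - q) ^ b = (1 - q) ^ (a - 1) / (1 + q) ^ a := by
    rw [show b - 1 = -a by linarith, show b = -(a - 1) by linarith, Real.rpow_neg h1.le,
      Real.rpow_neg h2.le, div_inv_eq_mul, mul_comm, div_eq_mul_inv]
  rw [h3]
  ring

theorem integral_square_eq_add_triangles {f : ℝ → ℝ → ℝ}
    (hf : Integrable (Function.uncurry f)
      ((volume.restrict (Ioc (0:ℝ) 1)).prod (volume.restrict (Ioc (0:ℝ) 1)))) :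
    ∫ x in (0:ℝ)..1, ∫ y in (0:ℝ)..1, f x y
      = (∫ x in (0:ℝ)..1, ∫ y in (0:ℝ)..x, f x y)
        + ∫ x in (0:ℝ)..1, ∫ y in (0:ℝ)..x, f y x := by
  have hm : MeasurableSet {z : ℝ × ℝ | z.2 ≤ z.1} := measurableSet_le measurable_snd measurable_fst
  have hm' : MeasurableSet {z : ℝ × ℝ | z.1 < z.2} := measurableSet_lt measurable_fst measurable_snd
  have hi1 := hf.indicator hm
  have hi2 := hf.indicator hm'
  have e : Function.uncurry f = fun z => {z : ℝ × ℝ | z.2 ≤ z.1}.indicator (Function.uncurry f) z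
      + {z : ℝ × ℝ | z.1 < z.2}.indicator (Function.uncurry f) z := by
    ext z
    rcases le_or_gt z.2 z.1 with h | h
    · simp [h, not_lt.2 h]
    · simp [h, not_le.2 h]
  simp only [intervalIntegral.integral_of_le zero_le_one]
  have h1 : ∫ x in Ioc (0:ℝ) 1, ∫ y in Ioc (0:ℝ) 1, f x y
      = ∫ z, Function.uncurry f z
        ∂((volume.restrict (Ioc (0:ℝ) 1)).prod (volume.restrict (Ioc (0:ℝ) 1))) :=
    (integral_prod _ hf).symm
  rw [h1, e, integral_add hi1 hi2, integral_prod _ hi1, integral_prod_symm _ hi2]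
  congr 1
  · refine setIntegral_congr_fun measurableSet_Ioc fun x hx => ?_
    have : (fun y => {z : ℝ × ℝ | z.2 ≤ z.1}.indicator (Function.uncurry f) (x, y))
        = (Iic x).indicator (f x) := by
      ext y; simp [indicator_apply]
    simp only [this]
    rw [setIntegral_indicator measurableSet_Iic, Ioc_inter_Iic, min_eq_right hx.2,
      intervalIntegral.integral_of_le hx.1.le]
  · refine setIntegral_congr_fun measurableSet_Ioc fun x hx => ?_
    have : (fun y => {z : ℝ × ℝ | z.1 < z.2}.indicator (Function.uncurry f) (y, x))
        = (Iio x).indicator (fun y => f y x) := by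
      ext y; simp [indicator_apply]
    simp only [this]
    have h2 : Ioc (0:ℝ) 1 ∩ Iio x = Ioo 0 x := by
      ext y
      constructor
      · rintro ⟨h, h'⟩; exact ⟨h.1, h'⟩
      · rintro h; exact ⟨⟨h.1, h.2.le.trans hx.2⟩, h.2⟩
    rw [setIntegral_indicator measurableSet_Iio, h2,
      intervalIntegral.integral_of_le hx.1.le, integral_Ioc_eq_integral_Ioo]

/-- The heat content density at `x` coming from the points `x * s` with `s ∈ [0, 1]`. -/
noncomputable def heatDensity (b : ℝ) (F G : ℝ → ℝ) (h x : ℝ) : ℝ :=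
  ∫ s in (0:ℝ)..1, s ^ (-b) * (Real.exp (-(h⁻¹ * x * (1 - s)) ^ 2) * (F x * G (x * s)))

theorem continuous_heatDensity {b h : ℝ} {F G : ℝ → ℝ} (hb : b < 1) (hF : Continuous F)
    (hG : Continuous G) (hF0 : ∀ x, 0 ≤ F x) (hF1 : ∀ x, F x ≤ 1) (hG0 : ∀ x, 0 ≤ G x)
    (hG1 : ∀ x, G x ≤ 1) : Continuous (heatDensity b F G h) := by
  refine continuous_integral_mul
    (k := fun x s => Real.exp (-(h⁻¹ * x * (1 - s)) ^ 2) * (F x * G (x * s)))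
    (intervalIntegrable_rpow_neg hb) (by fun_prop) fun x s => ?_
  have h1 := hF0 x
  have h2 := hG0 (x * s)
  rw [abs_of_nonneg (by positivity)]
  exact mul_le_one₀ (exp_neg_sq_le_one _) (by positivity)
    (mul_le_one₀ (hF1 x) h2 (hG1 _))

theorem integral_heatKernel_eq_heatDensity {a b t x : ℝ} (F G : ℝ → ℝ) (hab : a + b = 1)
    (ht : 0 < t) (hx : 0 < x) :
    ∫ y in (0:ℝ)..x, Real.exp (-(x - y) ^ 2 / (4 * t)) * F x * G y * x ^ (-a) * y ^ (-b)
      = heatDensity b F G (2 * √t) x := by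
  have h := intervalIntegral.mul_integral_comp_mul_left (a := 0) (b := 1)
    (f := fun y => Real.exp (-(x - y) ^ 2 / (4 * t)) * F x * G y * x ^ (-a) * y ^ (-b)) x
  rw [mul_zero, mul_one] at h
  rw [← h, ← intervalIntegral.integral_const_mul, heatDensity]
  simp only [intervalIntegral.integral_of_le zero_le_one]
  refine setIntegral_congr_fun measurableSet_Ioc fun s hs => ?_
  have h1 : x * x ^ (-a) * x ^ (-b) = 1 := by
    rw [mul_assoc, ← Real.rpow_add hx, show -a + -b = -1 by linarith, Real.rpow_neg_one,
      mul_inv_cancel₀ hx.ne']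
  have h2 : -(x - x * s) ^ 2 / (4 * t) = -((2 * √t)⁻¹ * x * (1 - s)) ^ 2 := by
    have : √t ^ 2 = t := Real.sq_sqrt ht.le
    have h3 : ((2 * √t)⁻¹) ^ 2 = (4 * t)⁻¹ := by
      rw [inv_pow, mul_pow, this]; norm_num
    rw [mul_pow, mul_pow, h3]
    ring
  simp only [h2, Real.mul_rpow hx.le hs.1.le]
  linear_combination (Real.exp (-((2 * √t)⁻¹ * x * (1 - s)) ^ 2) * F x * G (x * s) * s ^ (-b)) * h1

theorem heatContentCutoff_eq {a b t : ℝ} {Ξ₁ Ξ₂ : ℝ → ℝ} (ha : a < 1) (hb : b < 1)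
    (hab : a + b = 1) (ht : 0 < t) (h₁ : Continuous Ξ₁) (h₂ : Continuous Ξ₂)
    (h₁0 : ∀ x, 0 ≤ Ξ₁ x) (h₁1 : ∀ x, Ξ₁ x ≤ 1) (h₂0 : ∀ x, 0 ≤ Ξ₂ x) (h₂1 : ∀ x, Ξ₂ x ≤ 1) :
    heatContentCutoff a b Ξ₁ Ξ₂ t = (√(4 * Real.pi * t))⁻¹ *
      ((∫ x in (0:ℝ)..1, heatDensity b Ξ₁ Ξ₂ (2 * √t) x)
        + ∫ x in (0:ℝ)..1, heatDensity a Ξ₂ Ξ₁ (2 * √t) x) := by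
  have hint : Integrable (Function.uncurry fun x y : ℝ =>
      Real.exp (-(x - y) ^ 2 / (4 * t)) * Ξ₁ x * Ξ₂ y * x ^ (-a) * y ^ (-b))
      ((volume.restrict (Ioc (0:ℝ) 1)).prod (volume.restrict (Ioc (0:ℝ) 1))) := by
    have h := (intervalIntegrable_rpow_neg ha).1.mul_prod (intervalIntegrable_rpow_neg hb).1
    have hc : Continuous fun z : ℝ × ℝ =>
        Real.exp (-(z.1 - z.2) ^ 2 / (4 * t)) * (Ξ₁ z.1 * Ξ₂ z.2) := by fun_prop
    refine (h.bdd_mul (c := 1) hc.aestronglyMeasurable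
      (Filter.Eventually.of_forall fun z => ?_)).congr (Filter.Eventually.of_forall fun z => ?_)
    · have e1 := h₁0 z.1
      have e2 := h₂0 z.2
      rw [Real.norm_of_nonneg (by positivity)]
      refine mul_le_one₀ (Real.exp_le_one_iff.2 ?_) (by positivity)
        (mul_le_one₀ (h₁1 _) e2 (h₂1 _))
      rw [neg_div]
      have : 0 ≤ (z.1 - z.2) ^ 2 / (4 * t) := by positivity
      linarith
    · simp only [Function.uncurry]
      ring
  rw [heatContentCutoff, integral_square_eq_add_triangles hint]
  congr 2
  · simp only [intervalIntegral.integral_of_le zero_le_one]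
    exact setIntegral_congr_fun measurableSet_Ioc fun x hx =>
      integral_heatKernel_eq_heatDensity Ξ₁ Ξ₂ hab ht hx.1
  · simp only [intervalIntegral.integral_of_le zero_le_one]
    refine setIntegral_congr_fun measurableSet_Ioc fun x hx => ?_
    rw [← integral_heatKernel_eq_heatDensity Ξ₂ Ξ₁ (by linarith : b + a = 1) ht hx.1]
    congr with y
    rw [show (y - x) ^ 2 = (x - y) ^ 2 by ring]
    ring

theorem abs_heatDensity_sub_le {b h x δ L : ℝ} {F G : ℝ → ℝ} (hb : b < 1) (hh : 0 < h)
    (hx : x ∈ Ioc (0:ℝ) 1) (hδ : 0 < δ) (hL : 0 ≤ L) (hG : Continuous G)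
    (hF0 : ∀ x, 0 ≤ F x) (hF1 : ∀ x, F x ≤ 1) (hGone : ∀ x ≤ δ, G x = 1)
    (hGL : ∀ x ∈ Icc (0:ℝ) 1, ∀ y ∈ Icc (0:ℝ) 1, |G x - G y| ≤ L * |x - y|) :
    |heatDensity b F G h x
        - F x * G x * (gaussMean (h⁻¹ * x) + gaussExcess b (h⁻¹ * x))|
      ≤ L / δ ^ 2 * gaussConst b * h ^ 2 := by
  have hx0 := hx.1
  have hi := intervalIntegrable_rpow_neg hb
  have hi1 : IntervalIntegrable (fun s : ℝ => s ^ (-b) *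
      (Real.exp (-(h⁻¹ * x * (1 - s)) ^ 2) * (F x * G (x * s)))) volume 0 1 :=
    hi.mul_continuousOn (by fun_prop)
  have hi2 : IntervalIntegrable (fun s : ℝ => s ^ (-b) *
      (Real.exp (-(h⁻¹ * x * (1 - s)) ^ 2) * (F x * G x))) volume 0 1 :=
    hi.mul_continuousOn (by fun_prop)
  have h1 : F x * G x * (gaussMean (h⁻¹ * x) + gaussExcess b (h⁻¹ * x))
      = ∫ s in (0:ℝ)..1, s ^ (-b) * (Real.exp (-(h⁻¹ * x * (1 - s)) ^ 2) * (F x * G x)) := by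
    rw [gaussMean, gaussExcess, ← intervalIntegral.integral_add
      (Continuous.intervalIntegrable (by fun_prop) _ _)
      ((intervalIntegrable_rpow_neg_sub_one hb).mul_continuousOn (by fun_prop)),
      ← intervalIntegral.integral_const_mul]
    congr with s
    ring
  have hG' : ∀ s ∈ Ioc (0:ℝ) 1, |G (x * s) - G x| ≤ L / δ ^ 2 * x ^ 2 * (1 - s) := by
    intro s hs
    have hs1 : 0 ≤ 1 - s := by linarith [hs.2]
    have hxs : x * s ≤ x := mul_le_of_le_one_right hx0.le hs.2
    rcases le_or_gt x δ with hxδ | hxδ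
    · rw [hGone _ hxδ, hGone _ (hxs.trans hxδ), sub_self, abs_zero]
      positivity
    · have h2 := hGL (x * s) ⟨by have := hs.1; positivity, hxs.trans hx.2⟩ x ⟨hx0.le, hx.2⟩
      have h3 : |x * s - x| = x * (1 - s) := by
        rw [abs_sub_comm, abs_of_nonneg (by linarith)]; ring
      rw [h3] at h2
      have h4 : 1 ≤ x ^ 2 / δ ^ 2 := (one_le_div (by positivity)).2 (by gcongr)
      calc _ ≤ _ := h2
        _ ≤ L * (1 * (1 - s)) := by have := hx.2; gcongr
        _ ≤ L * (x ^ 2 / δ ^ 2 * (1 - s)) := by gcongr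
        _ = _ := by ring
  rw [h1, heatDensity, ← intervalIntegral.integral_sub hi1 hi2, ← Real.norm_eq_abs]
  have hc : 0 < h⁻¹ * x := by positivity
  have hi3 : IntervalIntegrable (fun s : ℝ => L / δ ^ 2 * x ^ 2 *
      (s ^ (-b) * ((1 - s) * Real.exp (-(h⁻¹ * x * (1 - s)) ^ 2)))) volume 0 1 :=
    (hi.mul_continuousOn (by fun_prop)).const_mul _
  have h5 := intervalIntegral.norm_integral_le_of_norm_le (zero_le_one' ℝ)
    (f := fun s : ℝ => s ^ (-b) * (Real.exp (-(h⁻¹ * x * (1 - s)) ^ 2) * (F x * G (x * s)))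
      - s ^ (-b) * (Real.exp (-(h⁻¹ * x * (1 - s)) ^ 2) * (F x * G x)))
    (Filter.Eventually.of_forall fun s hs => by
      have e1 : 0 ≤ s ^ (-b) := Real.rpow_nonneg hs.1.le _
      have e2 := hG' s hs
      have e3 : |F x| ≤ 1 := by rw [abs_of_nonneg (hF0 x)]; exact hF1 x
      rw [show s ^ (-b) * (Real.exp (-(h⁻¹ * x * (1 - s)) ^ 2) * (F x * G (x * s)))
        - s ^ (-b) * (Real.exp (-(h⁻¹ * x * (1 - s)) ^ 2) * (F x * G x))
        = s ^ (-b) * (Real.exp (-(h⁻¹ * x * (1 - s)) ^ 2) * (F x * (G (x * s) - G x))) by ring,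
        Real.norm_eq_abs, abs_mul, abs_mul, abs_mul, abs_of_nonneg e1,
        abs_of_pos (Real.exp_pos _)]
      calc _ ≤ s ^ (-b) * (Real.exp (-(h⁻¹ * x * (1 - s)) ^ 2) *
            (1 * (L / δ ^ 2 * x ^ 2 * (1 - s)))) := by gcongr
        _ = _ := by ring) hi3
  refine h5.trans ?_
  rw [intervalIntegral.integral_const_mul]
  calc _ ≤ L / δ ^ 2 * x ^ 2 * (gaussConst b / (h⁻¹ * x) ^ 2) := by
        gcongr
        exact integral_rpow_neg_mul_exp_le hb hc
    _ = _ := by field_simp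

theorem abs_integral_mul_gaussMean_sub_le {ε h : ℝ} {φ : ℝ → ℝ} (hε : 0 < ε) (hε2 : ε ≤ 1 / 2)
    (hh : 0 < h) (hhε : h ≤ ε) (hφc : Continuous φ) (hφ0 : ∀ x, 0 ≤ φ x) (hφ1 : ∀ x, φ x ≤ 1)
    (hone : ∀ x ∈ Icc 0 ε, φ x = 1) (hzero : ∀ x, 1 / 2 ≤ x → φ x = 0) :
    |(∫ x in (0:ℝ)..1, φ x * gaussMean (h⁻¹ * x))
        - h * (√Real.pi / 2) * (Real.log (ε / h) + Real.eulerMascheroniConstant / 2 + Real.log 2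
          + ∫ x in ε..(1 / 2), φ x * x⁻¹)|
      ≤ (√Real.pi / (2 * ε) + 1 / (2 * ε ^ 2)) * h ^ 2 := by
  have hpi : 0 < √Real.pi := Real.sqrt_pos.2 Real.pi_pos
  have hc : Continuous fun x => φ x * gaussMean (h⁻¹ * x) :=
    hφc.mul (continuous_gaussMean.comp (by fun_prop))
  have hci : ∀ u v : ℝ, 0 < u → 0 < v → IntervalIntegrable (fun x => φ x * x⁻¹) volume u v := by
    intro u v hu hv
    refine ContinuousOn.intervalIntegrable (hφc.continuousOn.mul
      (continuousOn_inv₀.mono fun x hx => ?_))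
    have : 0 < min u v := lt_min hu hv
    exact (this.trans_le hx.1).ne'
  have hnear : ∫ x in (0:ℝ)..ε, φ x * gaussMean (h⁻¹ * x)
      = h * ∫ v in (0:ℝ)..(ε / h), gaussMean v := by
    have h1 := intervalIntegral.integral_comp_mul_left (a := 0) (b := ε) gaussMean
      (inv_pos.2 hh).ne'
    rw [mul_zero, inv_inv, smul_eq_mul, inv_mul_eq_div] at h1
    rw [← h1]
    refine intervalIntegral.integral_congr fun x hx => ?_
    rw [uIcc_of_le hε.le] at hx
    simp only [hone x hx, one_mul]
  have htail : ∫ x in ε..1, φ x * x⁻¹ = ∫ x in ε..(1 / 2), φ x * x⁻¹ := by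
    rw [← intervalIntegral.integral_add_adjacent_intervals
      (hci ε (1 / 2) hε (by norm_num)) (hci (1 / 2) 1 (by norm_num) one_pos)]
    have : ∫ x in (1 / 2 : ℝ)..1, φ x * x⁻¹ = ∫ x in (1 / 2 : ℝ)..1, (0:ℝ) := by
      refine intervalIntegral.integral_congr fun x hx => ?_
      rw [uIcc_of_le (by norm_num)] at hx
      simp only [hzero x hx.1, zero_mul]
    rw [this]
    simp
  have hfar : |(∫ x in ε..1, φ x * gaussMean (h⁻¹ * x))
      - h * (√Real.pi / 2) * ∫ x in ε..1, φ x * x⁻¹| ≤ 1 / (2 * ε ^ 2) * h ^ 2 := by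
    rw [← intervalIntegral.integral_const_mul, ← intervalIntegral.integral_sub
      (hc.intervalIntegrable _ _) ((hci ε 1 hε one_pos).const_mul _), ← Real.norm_eq_abs]
    have hle : ε ≤ 1 := by linarith
    have h1 := intervalIntegral.norm_integral_le_of_norm_le_const (a := ε) (b := 1)
      (C := 1 / (2 * ε ^ 2) * h ^ 2)
      (f := fun x => φ x * gaussMean (h⁻¹ * x) - h * (√Real.pi / 2) * (φ x * x⁻¹))
      (fun x hx => by
        rw [uIoc_of_le hle] at hx
        have hx0 : 0 < x := hε.trans hx.1
        have h2 := abs_gaussMean_sub_le (c := h⁻¹ * x) (by positivity)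
        have h3 : φ x * gaussMean (h⁻¹ * x) - h * (√Real.pi / 2) * (φ x * x⁻¹)
            = φ x * (gaussMean (h⁻¹ * x) - √Real.pi / (2 * (h⁻¹ * x))) := by
          field_simp
        rw [h3, Real.norm_eq_abs, abs_mul, abs_of_nonneg (hφ0 x)]
        calc _ ≤ 1 * (1 / (2 * (h⁻¹ * x) ^ 2)) := by
              gcongr
              exact hφ1 x
          _ = 1 / (2 * x ^ 2) * h ^ 2 := by field_simp
          _ ≤ _ := by
            have := hx.1.le
            gcongr)
    refine h1.trans (mul_le_of_le_one_right (by positivity) ?_)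
    rw [abs_of_nonneg (by linarith)]
    linarith
  have hN := abs_integral_gaussMean_sub_le (V := ε / h) ((one_le_div hh).2 hhε)
  have hsplit := intervalIntegral.integral_add_adjacent_intervals
    (hc.intervalIntegrable (μ := volume) 0 ε) (hc.intervalIntegrable (μ := volume) ε 1)
  rw [← hsplit, hnear, ← htail]
  set N := ∫ v in (0:ℝ)..(ε / h), gaussMean v
  set A := ∫ x in ε..1, φ x * gaussMean (h⁻¹ * x)
  set B := ∫ x in ε..1, φ x * x⁻¹
  set c := Real.log (ε / h) + Real.eulerMascheroniConstant / 2 + Real.log 2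
  have hdec : h * N + A - h * (√Real.pi / 2) * (c + B)
      = h * (√Real.pi / 2) * (2 / √Real.pi * N - c) + (A - h * (√Real.pi / 2) * B) := by
    field_simp
    ring
  rw [hdec]
  calc _ ≤ |h * (√Real.pi / 2) * (2 / √Real.pi * N - c)| + |A - h * (√Real.pi / 2) * B| :=
        abs_add_le _ _
    _ ≤ h * (√Real.pi / 2) * (1 / (ε / h)) + 1 / (2 * ε ^ 2) * h ^ 2 := by
        rw [abs_mul, abs_of_pos (by positivity : 0 < h * (√Real.pi / 2))]
        gcongr
    _ = _ := by
        field_simp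

theorem exists_heatDensity_expansion {a b ε δ : ℝ} {F G : ℝ → ℝ} (ha0 : 0 < a) (ha : a < 1)
    (hab : a + b = 1) (hF : ContDiff ℝ 1 F) (hG : ContDiff ℝ 1 G) (hF0 : ∀ x, 0 ≤ F x)
    (hF1 : ∀ x, F x ≤ 1) (hG0 : ∀ x, 0 ≤ G x) (hG1 : ∀ x, G x ≤ 1) (hδ : 0 < δ)
    (hFone : ∀ x ≤ δ, F x = 1) (hGone : ∀ x ≤ δ, G x = 1)
    (hFzero : ∀ x, 1 / 2 ≤ x → F x = 0) (hε : 0 < ε) (hεFG : ∀ x ∈ Icc 0 ε, F x * G x = 1) :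
    ∃ C : ℝ, ∀ h : ℝ, 0 < h → h ≤ ε →
      |((∫ x in (0:ℝ)..1, heatDensity b F G h x) + ∫ x in (0:ℝ)..1, heatDensity a G F h x)
        - h * √Real.pi * (Real.log (ε / h) + Real.eulerMascheroniConstant / 2 + Real.log 2
          + (∫ x in ε..(1 / 2), F x * G x * x⁻¹)
          + (excessIntegral a + excessIntegral b) / 2)| ≤ C * h ^ 2 := by
  have hb : b < 1 := by linarith
  have hb0 : 0 < b := by linarith
  have hlip : ∀ {f : ℝ → ℝ}, ContDiff ℝ 1 f → ∃ L : ℝ, 0 ≤ L ∧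
      ∀ x ∈ Icc (0:ℝ) 1, ∀ y ∈ Icc (0:ℝ) 1, |f x - f y| ≤ L * |x - y| := by
    intro f hf
    obtain ⟨K, hK⟩ := hf.contDiffOn.exists_lipschitzOnWith one_ne_zero (convex_Icc (0:ℝ) 1)
      isCompact_Icc
    exact ⟨K, K.2, fun x hx y hy => hK.dist_le_mul x hx y hy⟩
  obtain ⟨L₁, hL₁, hF_lip⟩ := hlip hF
  obtain ⟨L₂, hL₂, hG_lip⟩ := hlip hG
  have hFc := hF.continuous
  have hGc := hG.continuous
  have hφc : Continuous fun x => F x * G x := hFc.mul hGc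
  have hφ0 : ∀ x, 0 ≤ F x * G x := fun x => mul_nonneg (hF0 x) (hG0 x)
  have hφ1 : ∀ x, F x * G x ≤ 1 := fun x => mul_le_one₀ (hF1 x) (hG0 x) (hG1 x)
  have hφone : ∀ x ≤ δ, F x * G x = 1 := fun x hx => by rw [hFone x hx, hGone x hx, one_mul]
  have hφzero : ∀ x, 1 / 2 ≤ x → F x * G x = 0 := fun x hx => by rw [hFzero x hx, zero_mul]
  have hε2 : ε ≤ 1 / 2 := by
    by_contra! hcon
    have h1 := hεFG (1 / 2) ⟨by norm_num, hcon.le⟩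
    rw [hφzero _ le_rfl] at h1
    exact zero_ne_one h1
  refine ⟨L₂ / δ ^ 2 * gaussConst b + L₁ / δ ^ 2 * gaussConst a
    + 2 * (√Real.pi / (2 * ε) + 1 / (2 * ε ^ 2)) + gaussConst b / δ + gaussConst a / δ,
    fun h hh hhε => ?_⟩
  have hD₁ := continuous_heatDensity (h := h) hb hFc hGc hF0 hF1 hG0 hG1
  have hD₂ := continuous_heatDensity (h := h) ha hGc hFc hG0 hG1 hF0 hF1
  have hn : Continuous fun x => F x * G x * gaussMean (h⁻¹ * x) :=
    hφc.mul (continuous_gaussMean.comp (by fun_prop))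
  have hea : Continuous fun x => F x * G x * gaussExcess a (h⁻¹ * x) :=
    hφc.mul ((continuous_gaussExcess ha).comp (by fun_prop))
  have heb : Continuous fun x => F x * G x * gaussExcess b (h⁻¹ * x) :=
    hφc.mul ((continuous_gaussExcess hb).comp (by fun_prop))
  have hii : ∀ {f : ℝ → ℝ}, Continuous f → IntervalIntegrable f volume 0 1 :=
    fun hf => hf.intervalIntegrable _ _
  have key : ∀ {c L : ℝ} {P Q : ℝ → ℝ}, c < 1 → 0 ≤ L → Continuous Q → (∀ x, 0 ≤ P x) →
      (∀ x, P x ≤ 1) → (∀ x ≤ δ, Q x = 1) →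
      (∀ x ∈ Icc (0:ℝ) 1, ∀ y ∈ Icc (0:ℝ) 1, |Q x - Q y| ≤ L * |x - y|) →
      (∀ x, P x * Q x = F x * G x) → Continuous (heatDensity c P Q h) →
      Continuous (fun x => F x * G x * gaussExcess c (h⁻¹ * x)) →
      |(∫ x in (0:ℝ)..1, heatDensity c P Q h x)
        - ((∫ x in (0:ℝ)..1, F x * G x * gaussMean (h⁻¹ * x))
          + ∫ x in (0:ℝ)..1, F x * G x * gaussExcess c (h⁻¹ * x))|
        ≤ L / δ ^ 2 * gaussConst c * h ^ 2 := by
    intro c L P Q hc hL hQ hP0 hP1 hQ1 hQL hPQ hD he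
    have hne : Continuous fun x => F x * G x * gaussMean (h⁻¹ * x)
        + F x * G x * gaussExcess c (h⁻¹ * x) := hn.add he
    rw [← intervalIntegral.integral_add (hii hn) (hii he),
      ← intervalIntegral.integral_sub (hii hD) (hii hne), ← Real.norm_eq_abs]
    have h1 := intervalIntegral.norm_integral_le_of_norm_le_const (a := 0) (b := 1)
      (C := L / δ ^ 2 * gaussConst c * h ^ 2)
      (f := fun x => heatDensity c P Q h x - (F x * G x * gaussMean (h⁻¹ * x)
        + F x * G x * gaussExcess c (h⁻¹ * x))) (fun x hx => by
          rw [uIoc_of_le zero_le_one] at hx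
          rw [Real.norm_eq_abs, ← mul_add, ← hPQ]
          exact abs_heatDensity_sub_le hc hh hx hδ hL hQ hP0 hP1 hQ1 hQL)
    simpa using h1
  have k₁ := key hb hL₂ hGc hF0 hF1 hGone hG_lip (fun _ => rfl) hD₁ heb
  have k₂ := key ha hL₁ hFc hG0 hG1 hFone hF_lip (fun _ => mul_comm _ _) hD₂ hea
  have k₃ := abs_integral_mul_gaussMean_sub_le hε hε2 hh hhε hφc hφ0 hφ1 hεFG hφzero
  have k₄ := abs_integral_mul_gaussExcess_sub_le hb0 hb hδ hh hφc hφ0 hφ1 hφone hφzero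
  have k₅ := abs_integral_mul_gaussExcess_sub_le ha0 ha hδ hh hφc hφ0 hφ1 hφone hφzero
  have r₄ : gaussConst b * h ^ 2 / δ = gaussConst b / δ * h ^ 2 := by ring
  have r₅ : gaussConst a * h ^ 2 / δ = gaussConst a / δ * h ^ 2 := by ring
  rw [r₄] at k₄
  rw [r₅] at k₅
  rw [abs_le] at *
  constructor <;> linarith [k₁.1, k₁.2, k₂.1, k₂.2, k₃.1, k₃.2, k₄.1, k₄.2, k₅.1, k₅.2]

theorem Antitone.nonneg_and_le_one_of_cutoff {f : ℝ → ℝ} (hf : Antitone f)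
    (hone : ∃ δ > 0, ∀ x ≤ δ, f x = 1) (hzero : ∃ δ > 0, ∀ x, 1 / 2 - δ < x → f x = 0) :
    (∀ x, 0 ≤ f x) ∧ (∀ x, f x ≤ 1) ∧ ∀ x, 1 / 2 ≤ x → f x = 0 := by
  obtain ⟨δ, _, h1⟩ := hone
  obtain ⟨η, hη, h0⟩ := hzero
  refine ⟨fun x => ?_, fun x => ?_, fun x hx => h0 x (by linarith)⟩
  · rw [← h0 (max x (1 / 2)) (by linarith [le_max_right x (1 / 2 : ℝ)])]
    exact hf (le_max_left _ _)
  · rw [← h1 (min x δ) (min_le_right _ _)]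
    exact hf (min_le_left _ _)

/-- Theorem 1.2: log terms in the heat content asymptotics when `a + b = 1`. -/
theorem heatContentCutoff_log_expansion
    (a b : ℝ) (ha : a < 1) (hb : b < 1) (hab : a + b = 1)
    (Ξ₁ Ξ₂ : ℝ → ℝ)
    (hΞ₁smooth : ContDiff ℝ (⊤ : ℕ∞) Ξ₁) (hΞ₂smooth : ContDiff ℝ (⊤ : ℕ∞) Ξ₂)
    (hΞ₁mono : Antitone Ξ₁) (hΞ₂mono : Antitone Ξ₂)
    (hΞ₁one : ∃ δ > 0, ∀ x ≤ δ, Ξ₁ x = 1)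
    (hΞ₂one : ∃ δ > 0, ∀ x ≤ δ, Ξ₂ x = 1)
    (hΞ₁zero : ∃ δ > 0, ∀ x, 1/2 - δ < x → Ξ₁ x = 0)
    (hΞ₂zero : ∃ δ > 0, ∀ x, 1/2 - δ < x → Ξ₂ x = 0)
    (ε : ℝ) (hε : 0 < ε) (hεΞ : ∀ x ∈ Set.Icc (0:ℝ) ε, Ξ₁ x * Ξ₂ x = 1) :
    ∃ β₀ : ℝ,
      β₀ = (1/2) * Real.log (ε ^ 2) + (1/2) * Real.eulerMascheroniConstant
            + Real.log (Real.sqrt 2 - 1) + 2 * Real.log 2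
            + (∫ x in ε..(1/2), Ξ₁ x * Ξ₂ x * x⁻¹)
            + (1/2) * ∫ q in (0:ℝ)..1,
                q⁻¹ * ((1 + q) ^ (a - 1) / (1 - q) ^ a
                  + (1 - q) ^ (a - 1) / (1 + q) ^ a
                  - 2 / Real.sqrt (1 + q ^ 2)) ∧
      ∃ C > 0, ∃ t₀ > 0, ∀ t : ℝ, 0 < t → t < t₀ →
        |heatContentCutoff a b Ξ₁ Ξ₂ t - (β₀ - (1/2) * Real.log t)|
          ≤ C * Real.sqrt t * Real.log (1 / t) := by
  have hsm : ∀ {f : ℝ → ℝ}, ContDiff ℝ (⊤ : ℕ∞) f → ContDiff ℝ 1 f := fun hf =>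
    hf.of_le (by exact_mod_cast le_top)
  obtain ⟨h₁0, h₁1, h₁z⟩ := hΞ₁mono.nonneg_and_le_one_of_cutoff hΞ₁one hΞ₁zero
  obtain ⟨h₂0, h₂1, -⟩ := hΞ₂mono.nonneg_and_le_one_of_cutoff hΞ₂one hΞ₂zero
  obtain ⟨δ₁, hδ₁, h₁o⟩ := hΞ₁one
  obtain ⟨δ₂, hδ₂, h₂o⟩ := hΞ₂one
  have ha0 : 0 < a := by linarith
  obtain ⟨C, hC⟩ := exists_heatDensity_expansion ha0 ha hab (hsm hΞ₁smooth) (hsm hΞ₂smooth)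
    h₁0 h₁1 h₂0 h₂1 (lt_min hδ₁ hδ₂) (fun x hx => h₁o x (hx.trans (min_le_left _ _)))
    (fun x hx => h₂o x (hx.trans (min_le_right _ _))) h₁z hε hεΞ
  refine ⟨_, rfl, 2 * (|C| + 1), by positivity, min (Real.exp (-1)) (ε ^ 2 / 4),
    lt_min (Real.exp_pos _) (by positivity), fun t ht htt => ?_⟩
  have hst : 0 < √t := Real.sqrt_pos.2 ht
  have hpi : 1 ≤ √Real.pi := Real.one_le_sqrt.2 (by linarith [Real.pi_gt_three])
  have hlog : 1 ≤ Real.log (1 / t) := by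
    rw [one_div, Real.log_inv]
    have := Real.log_le_log ht (htt.le.trans (min_le_left _ _))
    rw [Real.log_exp] at this
    linarith
  have hhε : 2 * √t ≤ ε := by
    have h1 : √t ≤ ε / 2 := Real.sqrt_le_iff.2
      ⟨by positivity, by linarith [htt.le.trans (min_le_right _ _)]⟩
    linarith
  have hmain := hC (2 * √t) (by positivity) hhε
  have hsqrt : √(4 * Real.pi * t) = 2 * √t * √Real.pi := by
    rw [Real.sqrt_mul (by positivity), Real.sqrt_mul (by norm_num),
      show (4:ℝ) = 2 ^ 2 by norm_num, Real.sqrt_sq (by norm_num)]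
    ring
  have hlog2 : Real.log (ε / (2 * √t)) = Real.log ε - Real.log 2 - Real.log t / 2 := by
    rw [Real.log_div hε.ne' (by positivity), Real.log_mul two_ne_zero hst.ne',
      Real.log_sqrt ht.le]
    ring
  rw [hlog2, excessIntegral_add ha0 ha hab] at hmain
  rw [heatContentCutoff_eq ha hb hab ht hΞ₁smooth.continuous hΞ₂smooth.continuous h₁0 h₁1 h₂0 h₂1,
    hsqrt, Real.log_pow]
  set D := (∫ x in (0:ℝ)..1, heatDensity b Ξ₁ Ξ₂ (2 * √t) x)
    + ∫ x in (0:ℝ)..1, heatDensity a Ξ₂ Ξ₁ (2 * √t) x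
  set A := ∫ x in ε..(1 / 2), Ξ₁ x * Ξ₂ x * x⁻¹
  set I := ∫ q in (0:ℝ)..1, q⁻¹ * ((1 + q) ^ (a - 1) / (1 - q) ^ a
    + (1 - q) ^ (a - 1) / (1 + q) ^ a - 2 / √(1 + q ^ 2))
  set E := D - 2 * √t * √Real.pi * (Real.log ε - Real.log 2 - Real.log t / 2
    + Real.eulerMascheroniConstant / 2 + Real.log 2 + A
    + (I + 2 * (2 * Real.log 2 + Real.log (√2 - 1))) / 2) with hE
  have hrw : (2 * √t * √Real.pi)⁻¹ * D - (1 / 2 * ((2 : ℕ) * Real.log ε)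
      + 1 / 2 * Real.eulerMascheroniConstant + Real.log (√2 - 1) + 2 * Real.log 2 + A + 1 / 2 * I
      - 1 / 2 * Real.log t) = (2 * √t * √Real.pi)⁻¹ * E := by
    rw [hE]
    push_cast
    field_simp
    ring
  rw [hrw, abs_mul, abs_of_pos (by positivity)]
  calc (2 * √t * √Real.pi)⁻¹ * |E| ≤ (2 * √t * 1)⁻¹ * ((|C| + 1) * (2 * √t) ^ 2) := by
        gcongr
        exact hmain.trans (by gcongr; linarith [le_abs_self C])
    _ = 2 * (|C| + 1) * √t * 1 := by
        field_simp
    _ ≤ 2 * (|C| + 1) * √t * Real.log (1 / t) := by gcongr
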